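/- arXiv:2508.09365 — 2 statements merged into one kernel-verified Lean document; each statement's English description precedes it below -/
import Mathlib

section
/- Let p be a prime and F a field of characteristic p, and let σ denote the image in the group algebra F[C_p] of a fixed generator of C_p. Every finitely generated F[C_p]-module M is isomorphic, as an F[C_p]-module, to a finite direct sum ⊕_{i=1}^{n} F[C_p]/((σ−1)^{a_i}) of cyclic modules, where each exponent satisfies 1 ≤ a_i ≤ p. -/
open scoped DirectSum
open scoped Polynomial

/-- A finitely generated module over a quotient `S` of a PID `A` by a power `π ^ p` of an
irreducible element is a finite direct sum of cyclic modules `S / (π ^ a i)`, `1 ≤ a i ≤ p`. -/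
theorem exists_linearEquiv_directSum_quotient_pow {A S M : Type*} [CommRing A] [IsDomain A]
    [IsPrincipalIdealRing A] [CommRing S] [Algebra A S] [AddCommGroup M] [Module S M]
    [Module.Finite S M] {π : A} (hπ : Irreducible π) {p : ℕ}
    (hsurj : Function.Surjective (algebraMap A S))
    (hker : RingHom.ker (algebraMap A S) = Ideal.span {π ^ p}) :
    ∃ (n : ℕ) (a : Fin n → ℕ), (∀ i, 1 ≤ a i ∧ a i ≤ p) ∧
      Nonempty (M ≃ₗ[S] ⨁ i, S ⧸ Ideal.span {algebraMap A S π ^ a i}) := by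
  classical
  let : Module A M := Module.compHom M (algebraMap A S)
  have : IsScalarTower A S M := IsScalarTower.of_algebraMap_smul fun _ _ => rfl
  have : Module.Finite A S :=
    Module.Finite.of_surjective (Algebra.linearMap A S) hsurj
  have : Module.Finite A M := Module.Finite.trans S M
  have hzero : algebraMap A S (π ^ p) = 0 := by
    rw [← RingHom.mem_ker, hker]
    exact Ideal.mem_span_singleton_self _
  have hann (m : M) : π ^ p • m = 0 := by
    rw [← algebraMap_smul S, hzero, zero_smul]
  obtain ⟨d, k, ⟨e⟩⟩ := Module.torsion_by_prime_power_decomposition hπ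
    (fun m => ⟨⟨π ^ p, p, rfl⟩, hann m⟩ : Module.IsTorsion' M (Submonoid.powers π))
  have hk (i : Fin d) : k i ≤ p := by
    have h : π ^ p • DirectSum.lof A (Fin d) (fun i => A ⧸ A ∙ π ^ k i) i (Submodule.Quotient.mk 1)
        = 0 := by
      rw [← e.apply_symm_apply (DirectSum.lof _ _ _ _ _), ← map_smul, hann, map_zero]
    rw [← map_smul, ← Submodule.Quotient.mk_smul] at h
    have h' := DirectSum.of_injective (β := fun i => A ⧸ A ∙ π ^ k i) i (h.trans (map_zero _).symm)
    rw [Submodule.Quotient.mk_eq_zero, smul_eq_mul, mul_one] at h'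
    exact (pow_dvd_pow_iff hπ.ne_zero hπ.not_isUnit).mp (Ideal.mem_span_singleton.mp h')
  have hquot (j : ℕ) (hj : j ≤ p) :
      Nonempty ((A ⧸ A ∙ π ^ j) ≃ₗ[A] S ⧸ Ideal.span {algebraMap A S π ^ j}) := by
    let f : A →ₗ[A] S ⧸ Ideal.span {algebraMap A S π ^ j} :=
      ((Ideal.span {algebraMap A S π ^ j}).mkQ.restrictScalars A) ∘ₗ Algebra.linearMap A S
    have hf : Function.Surjective f := (Submodule.mkQ_surjective _).comp hsurj
    have hkerf : (A ∙ π ^ j) = LinearMap.ker f := by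
      have hcomap : LinearMap.ker f = (Ideal.span {algebraMap A S π ^ j}).comap (algebraMap A S) := by
        ext x
        exact Submodule.Quotient.mk_eq_zero _
      have hmap : Ideal.span {algebraMap A S π ^ j} =
          (Ideal.span {π ^ j}).map (algebraMap A S) := by
        rw [Ideal.map_span, Set.image_singleton, map_pow]
      rw [hcomap, hmap, Ideal.comap_map_of_surjective _ hsurj, ← RingHom.ker_eq_comap_bot, hker]
      exact (sup_eq_left.mpr (Ideal.span_singleton_le_span_singleton.mpr (pow_dvd_pow _ hj))).symm
    exact ⟨(Submodule.quotEquivOfEq _ _ hkerf).trans (f.quotKerEquivOfSurjective hf)⟩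
  let ι := {i // k i ≠ 0}
  let g : ι ≃ Fin (Fintype.card ι) := Fintype.equivFin ι
  let N (i : Fin d) := S ⧸ Ideal.span {algebraMap A S π ^ k i}
  have hsub (i : Fin d) (hi : k i = 0) : Subsingleton (N i) := by
    simp only [N, hi, pow_zero, Ideal.span_singleton_one]
    infer_instance
  let r : (Π i, N i) →ₗ[A] Π j : ι, N j := LinearMap.pi fun j => LinearMap.proj j.1
  have hr : Function.Bijective r := by
    refine ⟨fun x y hxy => funext fun i => ?_, fun y => ?_⟩
    · by_cases hi : k i = 0
      · exact (hsub i hi).elim _ _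
      · exact congrFun hxy ⟨i, hi⟩
    · exact ⟨fun i => if h : k i ≠ 0 then y ⟨i, h⟩ else 0, funext fun j => dif_pos j.2⟩
  refine ⟨_, fun j => k (g.symm j), fun j => ⟨Nat.one_le_iff_ne_zero.mpr (g.symm j).2, hk _⟩, ⟨?_⟩⟩
  refine LinearEquiv.extendScalarsOfSurjective hsurj (e ≪≫ₗ ?_)
  exact DFinsupp.mapRange.linearEquiv (fun i => (hquot (k i) (hk i)).some) ≪≫ₗ
    DirectSum.linearEquivFunOnFintype A _ N ≪≫ₗ LinearEquiv.ofBijective r hr ≪≫ₗ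
    LinearEquiv.piCongrLeft' A (fun j : ι => N j) g ≪≫ₗ
    (DirectSum.linearEquivFunOnFintype A _ fun j => N (g.symm j)).symm

section GroupAlgebra

variable (p : ℕ) [Fact p.Prime] (F : Type*) [Field F]

local notation "σ" => MonoidAlgebra.of F (Multiplicative (ZMod p)) (Multiplicative.ofAdd 1)

theorem aeval_of_sub_one_surjective :
    Function.Surjective (Polynomial.aeval (R := F) (σ - 1)) := by
  intro x
  induction x using MonoidAlgebra.induction_on with
  | of g =>
    refine ⟨(Polynomial.X + 1) ^ (Multiplicative.toAdd g).val, ?_⟩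
    rw [map_pow, map_add, Polynomial.aeval_X, map_one (Polynomial.aeval _), sub_add_cancel, ← map_pow,
      ← ofAdd_nsmul, nsmul_one, ZMod.natCast_zmod_val, ofAdd_toAdd]
  | add x y hx hy =>
    obtain ⟨⟨f, rfl⟩, ⟨g, rfl⟩⟩ := hx, hy
    exact ⟨f + g, map_add _ _ _⟩
  | smul r x hx =>
    obtain ⟨f, rfl⟩ := hx
    exact ⟨r • f, map_smul _ _ _⟩

theorem of_sub_one_pow_char [CharP F p] : (σ - 1) ^ p = 0 := by
  have : CharP (MonoidAlgebra F (Multiplicative (ZMod p))) p :=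
    charP_of_injective_algebraMap (algebraMap F _).injective p
  rw [sub_pow_char, one_pow, ← map_pow, ← ofAdd_nsmul, nsmul_one, CharP.cast_eq_zero, ofAdd_zero,
    map_one, sub_self]

theorem ker_aeval_of_sub_one [CharP F p] :
    RingHom.ker (Polynomial.aeval (R := F) (σ - 1)) = Ideal.span {Polynomial.X ^ p} := by
  have hle (f : F[X]) (hf : f ∈ Ideal.span {(Polynomial.X : F[X]) ^ p}) :
      Polynomial.aeval (σ - 1) f = 0 := by
    obtain ⟨q, rfl⟩ := Ideal.mem_span_singleton.mp hf
    rw [map_mul, map_pow, Polynomial.aeval_X, of_sub_one_pow_char, zero_mul]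
  refine le_antisymm (fun f hf => ?_) hle
  let φ := Ideal.Quotient.liftₐ _ (Polynomial.aeval (R := F) (σ - 1)) hle
  have hsurj : Function.Surjective φ.toLinearMap := fun x => by
    obtain ⟨f, rfl⟩ := aeval_of_sub_one_surjective p F x
    exact ⟨Ideal.Quotient.mk _ f, rfl⟩
  have : Module.Finite F (F[X] ⧸ Ideal.span {(Polynomial.X : F[X]) ^ p}) :=
    (Polynomial.monic_X_pow p).finite_quotient
  have hrank : Module.finrank F (F[X] ⧸ Ideal.span {(Polynomial.X : F[X]) ^ p}) =
      Module.finrank F (MonoidAlgebra F (Multiplicative (ZMod p))) := by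
    rw [finrank_quotient_span_eq_natDegree, Polynomial.natDegree_X_pow,
      (MonoidAlgebra.coeffLinearEquiv F).finrank_eq, Module.finrank_finsupp_self,
      Fintype.card_multiplicative, ZMod.card]
  have : Module.Finite F (MonoidAlgebra F (Multiplicative (ZMod p))) :=
    Module.Finite.of_surjective _ hsurj
  have hinj := (LinearMap.injective_iff_surjective_of_finrank_eq_finrank hrank).mpr hsurj
  exact Ideal.Quotient.eq_zero_iff_mem.mp
    (hinj ((show φ (Ideal.Quotient.mk _ f) = 0 from hf).trans (map_zero φ).symm))

end GroupAlgebra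

/-- Let `p` be a prime and `F` a field of characteristic `p`, and let `σ`
denote the image in the group algebra `F[C_p]` of a fixed generator of `C_p`
(here `C_p := Multiplicative (ZMod p)` and `σ` is the image of `Multiplicative.ofAdd 1`).
Every finitely generated `F[C_p]`-module `M` is isomorphic, as an `F[C_p]`-module, to a
finite direct sum `⊕_{i=1}^{n} F[C_p]/((σ-1)^(a i))` of cyclic modules, where each
exponent satisfies `1 ≤ a i ≤ p`. -/
theorem stmt2 (p : ℕ) [Fact p.Prime] (F : Type*) [Field F] [CharP F p]
    (M : Type*) [AddCommGroup M] [Module (MonoidAlgebra F (Multiplicative (ZMod p))) M]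
    (hM : Module.Finite (MonoidAlgebra F (Multiplicative (ZMod p))) M) :
    let R := MonoidAlgebra F (Multiplicative (ZMod p))
    let σ : R := MonoidAlgebra.of F (Multiplicative (ZMod p)) (Multiplicative.ofAdd (1 : ZMod p))
    ∃ (n : ℕ) (a : Fin n → ℕ), (∀ i, 1 ≤ a i ∧ a i ≤ p) ∧
      Nonempty (M ≃ₗ[R] DirectSum (Fin n) (fun i => R ⧸ Ideal.span {(σ - 1) ^ a i})) := by
  let : Algebra F[X] (MonoidAlgebra F (Multiplicative (ZMod p))) :=
    (Polynomial.aeval (R := F) (MonoidAlgebra.of F (Multiplicative (ZMod p))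
      (Multiplicative.ofAdd (1 : ZMod p)) - 1)).toAlgebra
  intro R σ
  have h := exists_linearEquiv_directSum_quotient_pow (S := R) (M := M)
    (Polynomial.irreducible_X (R := F)) (aeval_of_sub_one_surjective p F) (ker_aeval_of_sub_one p F)
  have hX : algebraMap F[X] R Polynomial.X = σ - 1 := Polynomial.aeval_X _
  rwa [hX] at h
end

section
/- For any field F and any finite group G, the group algebra F[G] is self-injective: F[G] is an injective module over itself. Consequently, any submodule of an F[G]-module that is isomorphic to F[G] is a direct summand. -/
namespace MonoidAlgebra

/-- An element of the group algebra of a finite group is recovered from the coefficients at `1`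
of its translates. -/
theorem sum_single_inv_mul_single_coeff_one {k G : Type*} [Semiring k] [Group G] [Fintype G]
    (x : MonoidAlgebra k G) :
    ∑ g : G, single g⁻¹ (1 : k) * single 1 ((single g (1 : k) * x).coeff 1) = x := by
  classical
  ext a
  rw [coeff_sum, Finset.sum_apply', Finset.sum_eq_single a⁻¹]
  · simp [coeff_single_mul_apply]
  · intro g _ hg
    have hga : g⁻¹ ≠ a := fun h => hg (by rw [← h, inv_inv])
    simp [hga]
  · simp

/-- The group algebra of a finite group over a field satisfies Baer's criterion. -/
theorem baer_self (k G : Type*) [Field k] [Group G] [Finite G] :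
    Module.Baer (MonoidAlgebra k G) (MonoidAlgebra k G) := by
  intro I f
  cases nonempty_fintype G
  let ε : MonoidAlgebra k G →ₗ[k] MonoidAlgebra k G :=
    { toFun x := single 1 (x.coeff 1)
      map_add' x y := by simp
      map_smul' c x := by simp }
  let p : I.restrictScalars k →ₗ[k] MonoidAlgebra k G := ε ∘ₗ f.restrictScalars k
  obtain ⟨π, hπ⟩ := LinearMap.exists_extend p
  refine ⟨π.sumOfConjugatesEquivariant G, fun x hx => ?_⟩
  rw [LinearMap.sumOfConjugatesEquivariant_apply]
  refine Eq.trans (Finset.sum_congr rfl fun g _ => ?_)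
    (sum_single_inv_mul_single_coeff_one (f ⟨x, hx⟩))
  have hgx : single g (1 : k) * x ∈ I := I.mul_mem_left _ hx
  have hπg : π (single g (1 : k) * x) = ε (f (single g (1 : k) • ⟨x, hx⟩)) :=
    LinearMap.congr_fun hπ ⟨_, hgx⟩
  rw [LinearMap.conjugate_apply, smul_eq_mul, smul_eq_mul, hπg, map_smul]
  rfl

end MonoidAlgebra

/-- A submodule that is an injective module is a direct summand. -/
theorem Submodule.exists_isCompl_of_baer {R M : Type*} [Ring R] [AddCommGroup M] [Module R M]
    (N : Submodule R M) (hN : Module.Baer R N) : ∃ N' : Submodule R M, IsCompl N N' := by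
  obtain ⟨h, hh⟩ := hN.extension_property N.subtype N.injective_subtype LinearMap.id
  exact ⟨LinearMap.ker h, LinearMap.isCompl_of_proj fun x => LinearMap.congr_fun hh x⟩


/-- For any field `F` and any finite group `G`, the group algebra `F[G]`
is self-injective: `F[G]` is an injective module over itself. Consequently, any submodule
of an `F[G]`-module that is isomorphic to `F[G]` is a direct summand. -/
theorem stmt5 (F : Type) [Field F] (G : Type) [Group G] [Finite G] :
    Module.Injective (MonoidAlgebra F G) (MonoidAlgebra F G) ∧
    ∀ (M : Type) [AddCommGroup M] [Module (MonoidAlgebra F G) M]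
      (N : Submodule (MonoidAlgebra F G) M),
      Nonempty (N ≃ₗ[MonoidAlgebra F G] MonoidAlgebra F G) →
      ∃ N' : Submodule (MonoidAlgebra F G) M, IsCompl N N' := by
  have hB := MonoidAlgebra.baer_self F G
  exact ⟨hB.injective, fun M _ _ N ⟨e⟩ => N.exists_isCompl_of_baer (hB.of_equiv e.symm)⟩
end
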